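/- For all integers k,s ≥ 1 and c ∈ {0,1}, the set 𝓑 = 𝓑₁₁ ∪ 𝓑₁₂ ∪ 𝓑₂₁ ∪ 𝓑₂₂ is an F-basis of A^{k,s}_c; in particular dim_F A^{k,s}_c = 9k + s. -/

import Mathlib

/- Common setup: the algebras D(2B)^{k,s}(c) of dihedral type, over a field F,
   presented as a quotient of the free algebra on the paths-generators
   e₁, e₂ (trivial paths), α (loop at vertex 1), β (arrow 1 → 2),
   γ (arrow 2 → 1), η (loop at vertex 2), by the path-algebra relations
   together with Erdmann's relations
   βη = 0, ηγ = 0, γβ = 0, α² = c(αβγ)^k, (αβγ)^k = (βγα)^k, η^s = (γαβ)^k. -/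

noncomputable section

namespace DihedralPaper

inductive Gen : Type
  | e1 | e2 | a | b | g | h

variable (F : Type) [Field F]

/-- The generators inside the free algebra. -/
def gen (t : Gen) : FreeAlgebra F Gen := FreeAlgebra.ι F t

/-- The defining relations of `D(2B)^{k,s}(c)` (paths written from left to right). -/
inductive Rel (k s : ℕ) (c : F) : FreeAlgebra F Gen → FreeAlgebra F Gen → Prop
  | unit : Rel k s c (gen F .e1 + gen F .e2) 1
  | idem1 : Rel k s c (gen F .e1 * gen F .e1) (gen F .e1)
  | idem2 : Rel k s c (gen F .e2 * gen F .e2) (gen F .e2)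
  | orth12 : Rel k s c (gen F .e1 * gen F .e2) 0
  | orth21 : Rel k s c (gen F .e2 * gen F .e1) 0
  | aL : Rel k s c (gen F .e1 * gen F .a) (gen F .a)
  | aR : Rel k s c (gen F .a * gen F .e1) (gen F .a)
  | bL : Rel k s c (gen F .e1 * gen F .b) (gen F .b)
  | bR : Rel k s c (gen F .b * gen F .e2) (gen F .b)
  | gL : Rel k s c (gen F .e2 * gen F .g) (gen F .g)
  | gR : Rel k s c (gen F .g * gen F .e1) (gen F .g)
  | hL : Rel k s c (gen F .e2 * gen F .h) (gen F .h)
  | hR : Rel k s c (gen F .h * gen F .e2) (gen F .h)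
  | bh : Rel k s c (gen F .b * gen F .h) 0
  | hg : Rel k s c (gen F .h * gen F .g) 0
  | gb : Rel k s c (gen F .g * gen F .b) 0
  | asq : Rel k s c (gen F .a * gen F .a) (c • (gen F .a * gen F .b * gen F .g) ^ k)
  | abg : Rel k s c ((gen F .a * gen F .b * gen F .g) ^ k) ((gen F .b * gen F .g * gen F .a) ^ k)
  | hs : Rel k s c ((gen F .h) ^ s) ((gen F .g * gen F .a * gen F .b) ^ k)

/-- The algebra `A^{k,s}_c = D(2B)^{k,s}(c)`. -/
def DA (k s : ℕ) (c : F) : Type := RingQuot (Rel F k s c)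

instance (k s : ℕ) (c : F) : Ring (DA F k s c) :=
  inferInstanceAs (Ring (RingQuot (Rel F k s c)))

instance (k s : ℕ) (c : F) : Algebra F (DA F k s c) :=
  inferInstanceAs (Algebra F (RingQuot (Rel F k s c)))

variable (k s : ℕ) (c : F)

/-- The canonical projection. -/
def mk : FreeAlgebra F Gen →ₐ[F] DA F k s c := RingQuot.mkAlgHom F (Rel F k s c)

def E1 : DA F k s c := mk F k s c (gen F .e1)
def E2 : DA F k s c := mk F k s c (gen F .e2)
/-- The image of the loop α at vertex 1. -/
def Al : DA F k s c := mk F k s c (gen F .a)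
/-- The image of the arrow β : 1 → 2. -/
def Be : DA F k s c := mk F k s c (gen F .b)
/-- The image of the arrow γ : 2 → 1. -/
def Ga : DA F k s c := mk F k s c (gen F .g)
/-- The image of the loop η at vertex 2. -/
def Et : DA F k s c := mk F k s c (gen F .h)

/-- The path αβγ. -/
def ABG : DA F k s c := Al F k s c * Be F k s c * Ga F k s c
/-- The path βγα. -/
def BGA : DA F k s c := Be F k s c * Ga F k s c * Al F k s c
/-- The path γαβ. -/
def GAB : DA F k s c := Ga F k s c * Al F k s c * Be F k s c

/-- The standard basis paths 𝓑₁₁ of e₁Ae₁. -/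
def B11 : Set (DA F k s c) :=
  {E1 F k s c, Al F k s c, Be F k s c * Ga F k s c, (ABG F k s c) ^ k}
    ∪ (fun i => (ABG F k s c) ^ i) '' Set.Icc 1 (k - 1)
    ∪ (fun i => (ABG F k s c) ^ i * Al F k s c) '' Set.Icc 1 (k - 1)
    ∪ (fun i => (BGA F k s c) ^ i) '' Set.Icc 1 (k - 1)
    ∪ (fun i => (BGA F k s c) ^ i * (Be F k s c * Ga F k s c)) '' Set.Icc 1 (k - 1)

/-- The standard basis paths 𝓑₁₂ of e₁Ae₂. -/
def B12 : Set (DA F k s c) :=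
  {Be F k s c, Al F k s c * Be F k s c}
    ∪ (fun i => (BGA F k s c) ^ i * Be F k s c) '' Set.Icc 1 (k - 1)
    ∪ (fun i => (ABG F k s c) ^ i * (Al F k s c * Be F k s c)) '' Set.Icc 1 (k - 1)

/-- The standard basis paths 𝓑₂₁ of e₂Ae₁. -/
def B21 : Set (DA F k s c) :=
  {Ga F k s c, Ga F k s c * Al F k s c}
    ∪ (fun i => (GAB F k s c) ^ i * Ga F k s c) '' Set.Icc 1 (k - 1)
    ∪ (fun i => (GAB F k s c) ^ i * (Ga F k s c * Al F k s c)) '' Set.Icc 1 (k - 1)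

/-- The standard basis paths 𝓑₂₂ of e₂Ae₂. -/
def B22 : Set (DA F k s c) :=
  {E2 F k s c}
    ∪ (fun i => (GAB F k s c) ^ i) '' Set.Icc 1 (k - 1)
    ∪ (fun j => (Et F k s c) ^ j) '' Set.Icc 1 s

/-- The standard path basis 𝓑 of `A^{k,s}_c`. -/
def BB : Set (DA F k s c) :=
  B11 F k s c ∪ B12 F k s c ∪ B21 F k s c ∪ B22 F k s c

/-- The commutator subspace K(A): the F-linear span of all commutators. -/
def Kspan (A : Type) [Ring A] [Algebra F A] : Submodule F A :=
  Submodule.span F {z : A | ∃ u v : A, z = u * v - v * u}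

/-- The (left) socle of a ring: the sum of all simple (left) submodules. -/
def socle (A : Type) [Ring A] : Submodule A A := sSup {S : Submodule A A | IsAtom S}

/-- `ψ` is the linear form sending each standard basis path lying in the socle to 1
    and every other standard basis path to 0. -/
def SoclePsi (ψ : DA F k s c →ₗ[F] F) : Prop :=
  ∀ p ∈ BB F k s c,
    (p ∈ socle (DA F k s c) → ψ p = 1) ∧ (p ∉ socle (DA F k s c) → ψ p = 0)

/-- `T₁(A) = {x : x² ∈ K(A)}`. -/
def T1set : Set (DA F k s c) := {z | z ^ 2 ∈ Kspan F (DA F k s c)}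

/-- The orthogonal space `T₁(A)^⊥` with respect to the form `⟨x, y⟩ = ψ(xy)`. -/
def T1perp (ψ : DA F k s c →ₗ[F] F) : Set (DA F k s c) :=
  {y | ∀ x ∈ T1set F k s c, ψ (y * x) = 0}

/-- The first generalized Reynolds ideal, as an ideal of the center `Z(A)`. -/
def ReynoldsIdeal (ψ : DA F k s c →ₗ[F] F) :
    Ideal (Subalgebra.center F (DA F k s c)) :=
  Ideal.span {z : Subalgebra.center F (DA F k s c) | (z : DA F k s c) ∈ T1perp F k s c ψ}


/-! ### The regular representation, written down explicitly -/

section Model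

/-- Labels of the standard basis paths: the nonzero paths read as left-growing chains
`e₁, α, γα, …`, then `γ, βγ, αβγ, …`, then `e₂, β, αβ, …`, and then `η, η², …`. -/
abbrev Idx (k s : ℕ) : Type := Fin (3 * k) ⊕ Fin (3 * k) ⊕ Fin (3 * k) ⊕ Fin s

/-- The path of length `n + 1` in the chain `γ, βγ, αβγ, …`. -/
def vQ (n : ℕ) : Idx k s →₀ F :=
  if h : n < 3 * k then Finsupp.single (.inr (.inl ⟨n, h⟩)) 1 else 0

/-- The path `η ^ (n + 1)`. -/
def vS (n : ℕ) : Idx k s →₀ F :=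
  if h : n < s then Finsupp.single (.inr (.inr (.inr ⟨n, h⟩))) 1 else 0

/-- The path of length `n` in the chain `e₁, α, γα, βγα, …`. -/
def vP (n : ℕ) : Idx k s →₀ F :=
  if h : n < 3 * k then Finsupp.single (.inl ⟨n, h⟩) 1
  else if n = 3 * k then vQ F k s (3 * k - 1) else 0

/-- The path of length `n` in the chain `e₂, β, αβ, γαβ, …`. -/
def vR (n : ℕ) : Idx k s →₀ F :=
  if h : n < 3 * k then Finsupp.single (.inr (.inr (.inl ⟨n, h⟩))) 1
  else if n = 3 * k then vS F k s (s - 1) else 0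

/-- Left multiplication of a standard basis path by a generator. -/
def act : Gen → Idx k s → (Idx k s →₀ F)
  | .e1, .inl n => if n.1 % 3 = 2 then 0 else vP F k s n
  | .e1, .inr (.inl n) => if n.1 % 3 = 0 then 0 else vQ F k s n
  | .e1, .inr (.inr (.inl n)) => if n.1 % 3 = 0 then 0 else vR F k s n
  | .e1, .inr (.inr (.inr _)) => 0
  | .e2, .inl n => if n.1 % 3 = 2 then vP F k s n else 0
  | .e2, .inr (.inl n) => if n.1 % 3 = 0 then vQ F k s n else 0
  | .e2, .inr (.inr (.inl n)) => if n.1 % 3 = 0 then vR F k s n else 0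
  | .e2, .inr (.inr (.inr n)) => vS F k s n
  | .a, .inl n => if n.1 % 3 = 0 then vP F k s (n + 1)
      else if n.1 = 1 then c • vQ F k s (3 * k - 1) else 0
  | .a, .inr (.inl n) => if n.1 % 3 = 1 then vQ F k s (n + 1) else 0
  | .a, .inr (.inr (.inl n)) => if n.1 % 3 = 1 then vR F k s (n + 1) else 0
  | .a, .inr (.inr (.inr _)) => 0
  | .b, .inl n => if n.1 % 3 = 2 then vP F k s (n + 1) else 0
  | .b, .inr (.inl n) => if n.1 % 3 = 0 then vQ F k s (n + 1) else 0
  | .b, .inr (.inr (.inl n)) => if n.1 % 3 = 0 then vR F k s (n + 1) else 0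
  | .b, .inr (.inr (.inr _)) => 0
  | .g, .inl n => if n.1 = 0 then vQ F k s 0
      else if n.1 % 3 = 1 then vP F k s (n + 1) else 0
  | .g, .inr (.inl n) => if n.1 % 3 = 2 then vQ F k s (n + 1) else 0
  | .g, .inr (.inr (.inl n)) => if n.1 % 3 = 2 then vR F k s (n + 1) else 0
  | .g, .inr (.inr (.inr _)) => 0
  | .h, .inl _ => 0
  | .h, .inr (.inl _) => 0
  | .h, .inr (.inr (.inl n)) => if n.1 = 0 then vS F k s 0 else 0
  | .h, .inr (.inr (.inr n)) => vS F k s (n + 1)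

/-- The operator by which a generator acts on the model. -/
def op (t : Gen) : Module.End F (Idx k s →₀ F) :=
  Finsupp.linearCombination F (act F k s c t)

variable {F k s}

lemma vQ_eq_zero {n : ℕ} (h : 3 * k ≤ n) : vQ F k s n = 0 := dif_neg (by omega)

lemma vS_eq_zero {n : ℕ} (h : s ≤ n) : vS F k s n = 0 := dif_neg (by omega)

lemma vP_eq_zero {n : ℕ} (h : 3 * k < n) : vP F k s n = 0 := by
  rw [vP, dif_neg (by omega), if_neg (by omega)]

lemma vR_eq_zero {n : ℕ} (h : 3 * k < n) : vR F k s n = 0 := by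
  rw [vR, dif_neg (by omega), if_neg (by omega)]

lemma vP_top : vP F k s (3 * k) = vQ F k s (3 * k - 1) := by simp [vP]

lemma vR_top : vR F k s (3 * k) = vS F k s (s - 1) := by simp [vR]

lemma vP_of_lt {n : ℕ} (h : n < 3 * k) : vP F k s n = Finsupp.single (.inl ⟨n, h⟩) 1 :=
  dif_pos h

lemma vQ_of_lt {n : ℕ} (h : n < 3 * k) :
    vQ F k s n = Finsupp.single (.inr (.inl ⟨n, h⟩)) 1 := dif_pos h

lemma vR_of_lt {n : ℕ} (h : n < 3 * k) :
    vR F k s n = Finsupp.single (.inr (.inr (.inl ⟨n, h⟩))) 1 := dif_pos h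

lemma vS_of_lt {n : ℕ} (h : n < s) :
    vS F k s n = Finsupp.single (.inr (.inr (.inr ⟨n, h⟩))) 1 := dif_pos h

lemma op_single (t : Gen) (i : Idx k s) :
    op F k s c t (Finsupp.single i 1) = act F k s c t i := by simp [op]

/-- Endomorphisms of the model that agree on all chains are equal. -/
lemma model_ext {f g : Module.End F (Idx k s →₀ F)}
    (hP : ∀ n, f (vP F k s n) = g (vP F k s n)) (hQ : ∀ n, f (vQ F k s n) = g (vQ F k s n))
    (hR : ∀ n, f (vR F k s n) = g (vR F k s n)) (hS : ∀ n, f (vS F k s n) = g (vS F k s n)) :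
    f = g := by
  refine Finsupp.lhom_ext' fun i => LinearMap.ext_ring ?_
  rcases i with i | i | i | i
  · simpa [vP_of_lt i.2] using hP i
  · simpa [vQ_of_lt i.2] using hQ i
  · simpa [vR_of_lt i.2] using hR i
  · simpa [vS_of_lt i.2] using hS i

lemma op_vQ (t : Gen) (n : ℕ) : op F k s c t (vQ F k s n) = match t with
    | .e1 => if n % 3 = 0 then 0 else vQ F k s n
    | .e2 => if n % 3 = 0 then vQ F k s n else 0
    | .a => if n % 3 = 1 then vQ F k s (n + 1) else 0
    | .b => if n % 3 = 0 then vQ F k s (n + 1) else 0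
    | .g => if n % 3 = 2 then vQ F k s (n + 1) else 0
    | .h => 0 := by
  rcases lt_or_ge n (3 * k) with h | h
  · rw [vQ_of_lt h, op_single]
    cases t <;> simp [act, vQ_of_lt h]
  · cases t <;> simp [vQ_eq_zero h, vQ_eq_zero (h.trans n.le_succ)]

lemma op_vS (t : Gen) (n : ℕ) : op F k s c t (vS F k s n) = match t with
    | .e2 => vS F k s n
    | .h => vS F k s (n + 1)
    | _ => 0 := by
  rcases lt_or_ge n s with h | h
  · rw [vS_of_lt h, op_single]
    cases t <;> simp [act, vS_of_lt h]
  · cases t <;> simp [vS_eq_zero h, vS_eq_zero (h.trans n.le_succ)]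

lemma op_vP (hk : 1 ≤ k) (t : Gen) (n : ℕ) : op F k s c t (vP F k s n) = match t with
    | .e1 => if n % 3 = 2 then 0 else vP F k s n
    | .e2 => if n % 3 = 2 then vP F k s n else 0
    | .a => if n % 3 = 0 then vP F k s (n + 1)
        else if n = 1 then c • vQ F k s (3 * k - 1) else 0
    | .b => if n % 3 = 2 then vP F k s (n + 1) else 0
    | .g => if n = 0 then vQ F k s 0 else if n % 3 = 1 then vP F k s (n + 1) else 0
    | .h => 0 := by
  rcases lt_trichotomy n (3 * k) with h | rfl | h
  · rw [vP_of_lt h, op_single]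
    cases t <;> simp [act, vP_of_lt h]
  · rw [vP_top, op_vQ, vP_eq_zero (Nat.lt_succ_self _)]
    have h1 : (3 * k - 1) % 3 = 2 := by omega
    have h2 : 3 * k - 1 + 1 = 3 * k := by omega
    have h3 : k ≠ 0 := by omega
    cases t <;> simp [h1, h2, h3, vQ_eq_zero]
  · have h3 : n ≠ 0 := by omega
    have h4 : n ≠ 1 := by omega
    cases t <;> simp [vP_eq_zero h, vP_eq_zero (h.trans n.lt_succ_self), h3, h4]

lemma op_vR (hk : 1 ≤ k) (hs : 1 ≤ s) (t : Gen) (n : ℕ) :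
    op F k s c t (vR F k s n) = match t with
    | .e1 => if n % 3 = 0 then 0 else vR F k s n
    | .e2 => if n % 3 = 0 then vR F k s n else 0
    | .a => if n % 3 = 1 then vR F k s (n + 1) else 0
    | .b => if n % 3 = 0 then vR F k s (n + 1) else 0
    | .g => if n % 3 = 2 then vR F k s (n + 1) else 0
    | .h => if n = 0 then vS F k s 0 else 0 := by
  rcases lt_trichotomy n (3 * k) with h | rfl | h
  · rw [vR_of_lt h, op_single]
    cases t <;> simp [act, vR_of_lt h]
  · rw [vR_top, op_vS, vR_eq_zero (Nat.lt_succ_self _)]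
    have h2 : s - 1 + 1 = s := by omega
    have h3 : k ≠ 0 := by omega
    cases t <;> simp [h2, h3, vS_eq_zero]
  · have h3 : n ≠ 0 := by omega
    cases t <;> simp [vR_eq_zero h, vR_eq_zero (h.trans n.lt_succ_self), h3]

/-- Powers of an operator shifting one residue class of a chain by three steps and
annihilating the rest of the chain. -/
lemma pow_shift {V : Type} [AddCommGroup V] [Module F V] {f : Module.End F V} {v : ℕ → V} {a : ℕ}
    (hf : ∀ n, f (v n) = if n % 3 = a then v (n + 3) else 0) {j : ℕ} (hj : j ≠ 0) (n : ℕ) :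
    (f ^ j) (v n) = if n % 3 = a then v (n + 3 * j) else 0 := by
  induction j with
  | zero => exact absurd rfl hj
  | succ j ih =>
    rcases eq_or_ne j 0 with rfl | h0
    · simpa using hf n
    · rw [pow_succ', Module.End.mul_apply, ih h0]
      split_ifs with h
      · rw [hf, if_pos (by omega)]; rfl
      · simp

lemma abg_pow_op (hk : 1 ≤ k) (hs : 1 ≤ s) :
    ((op F k s c .a * op F k s c .b * op F k s c .g) ^ k) (vP F k s 0) = vQ F k s (3 * k - 1) ∧
    (∀ n, n ≠ 0 →
      ((op F k s c .a * op F k s c .b * op F k s c .g) ^ k) (vP F k s n) = 0) ∧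
    (∀ n, ((op F k s c .a * op F k s c .b * op F k s c .g) ^ k) (vQ F k s n) = 0) ∧
    (∀ n, ((op F k s c .a * op F k s c .b * op F k s c .g) ^ k) (vR F k s n) = 0) ∧
    (∀ n, ((op F k s c .a * op F k s c .b * op F k s c .g) ^ k) (vS F k s n) = 0) := by
  set f := op F k s c .a * op F k s c .b * op F k s c .g with hf
  have hk0 : k ≠ 0 := by omega
  have fQ : ∀ n, f (vQ F k s n) = if n % 3 = 2 then vQ F k s (n + 3) else 0 := by
    intro n
    simp only [hf, Module.End.mul_apply, op_vQ]
    split_ifs with h <;> simp [op_vQ, Nat.add_mod, h]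
  have fR : ∀ n, f (vR F k s n) = if n % 3 = 2 then vR F k s (n + 3) else 0 := by
    intro n
    simp only [hf, Module.End.mul_apply, op_vR c hk hs]
    split_ifs with h <;> simp [op_vR c hk hs, Nat.add_mod, h]
  have fP : ∀ n, f (vP F k s (n + 1)) = if n % 3 = 0 then vP F k s (n + 3 + 1) else 0 := by
    intro n
    have h0 : (n + 1) % 3 = 1 ↔ n % 3 = 0 := by omega
    simp only [hf, Module.End.mul_apply, op_vP c hk, h0]
    split_ifs with h <;> simp_all [op_vP c hk, Nat.add_mod]
  have fP0 : f (vP F k s 0) = vQ F k s 2 := by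
    simp [hf, Module.End.mul_apply, op_vP c hk, op_vQ]
  have fS : ∀ n, f (vS F k s n) = 0 := by
    intro n
    simp [hf, Module.End.mul_apply, op_vS]
  refine ⟨?_, fun n hn => ?_, fun n => ?_, fun n => ?_, fun n => ?_⟩
  · obtain ⟨j, rfl⟩ : ∃ j, k = j + 1 := ⟨k - 1, by omega⟩
    rw [pow_succ, Module.End.mul_apply, fP0]
    rcases eq_or_ne j 0 with rfl | h0
    · simp
    · rw [pow_shift fQ h0, if_pos rfl]
      congr 1
      omega
  · obtain ⟨m, rfl⟩ := Nat.exists_eq_succ_of_ne_zero hn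
    rw [Nat.succ_eq_add_one, pow_shift (v := fun n => vP F k s (n + 1)) fP hk0,
      vP_eq_zero (by omega), ite_self]
  · rw [pow_shift fQ hk0, vQ_eq_zero (by omega), ite_self]
  · rw [pow_shift fR hk0]
    split_ifs with h
    · exact vR_eq_zero (by omega)
    · rfl
  · obtain ⟨j, rfl⟩ : ∃ j, k = j + 1 := ⟨k - 1, by omega⟩
    rw [pow_succ, Module.End.mul_apply, fS, map_zero]

lemma bga_pow_op (hk : 1 ≤ k) (hs : 1 ≤ s) :
    ((op F k s c .b * op F k s c .g * op F k s c .a) ^ k) =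
      ((op F k s c .a * op F k s c .b * op F k s c .g) ^ k) := by
  obtain ⟨hP0, hP, hQ, hR, hS⟩ := abg_pow_op (F := F) c hk hs
  set f := op F k s c .b * op F k s c .g * op F k s c .a with hf
  have hk0 : k ≠ 0 := by omega
  have fQ : ∀ n, f (vQ F k s n) = if n % 3 = 1 then vQ F k s (n + 3) else 0 := by
    intro n
    simp only [hf, Module.End.mul_apply, op_vQ]
    split_ifs with h <;> simp [op_vQ, Nat.add_mod, h]
  have fR : ∀ n, f (vR F k s n) = if n % 3 = 1 then vR F k s (n + 3) else 0 := by
    intro n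
    simp only [hf, Module.End.mul_apply, op_vR c hk hs]
    split_ifs with h <;> simp [op_vR c hk hs, Nat.add_mod, h]
  have fP : ∀ n, f (vP F k s n) = if n % 3 = 0 then vP F k s (n + 3) else 0 := by
    intro n
    simp only [hf, Module.End.mul_apply, op_vP c hk]
    split_ifs with h h'
    · simp [op_vP c hk, Nat.add_mod, h]
    · have h1 : (3 * k - 1) % 3 = 2 := by omega
      have h2 : 3 * k - 1 + 1 = 3 * k := by omega
      simp [op_vQ, h1, h2, vQ_eq_zero]
    · simp
  have fS : ∀ n, f (vS F k s n) = 0 := by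
    intro n
    simp [hf, Module.End.mul_apply, op_vS]
  refine model_ext (fun n => ?_) (fun n => ?_) (fun n => ?_) (fun n => ?_)
  · rw [pow_shift fP hk0]
    rcases eq_or_ne n 0 with rfl | h0
    · rw [hP0, if_pos rfl, zero_add, vP_top]
    · rw [hP n h0, vP_eq_zero (by omega), ite_self]
  · rw [pow_shift fQ hk0, vQ_eq_zero (by omega), ite_self, hQ]
  · rw [pow_shift fR hk0, hR]
    split_ifs with h
    · exact vR_eq_zero (by omega)
    · rfl
  · rw [hS]
    obtain ⟨j, rfl⟩ : ∃ j, k = j + 1 := ⟨k - 1, by omega⟩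
    rw [pow_succ, Module.End.mul_apply, fS, map_zero]

lemma eta_pow_op (hk : 1 ≤ k) (hs : 1 ≤ s) :
    op F k s c .h ^ s = (op F k s c .g * op F k s c .a * op F k s c .b) ^ k := by
  set f := op F k s c .g * op F k s c .a * op F k s c .b with hf
  have hk0 : k ≠ 0 := by omega
  have fQ : ∀ n, f (vQ F k s n) = if n % 3 = 0 then vQ F k s (n + 3) else 0 := by
    intro n
    simp only [hf, Module.End.mul_apply, op_vQ]
    split_ifs with h <;> simp [op_vQ, Nat.add_mod, h]
  have fR : ∀ n, f (vR F k s n) = if n % 3 = 0 then vR F k s (n + 3) else 0 := by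
    intro n
    simp only [hf, Module.End.mul_apply, op_vR c hk hs]
    split_ifs with h <;> simp [op_vR c hk hs, Nat.add_mod, h]
  have fP : ∀ n, f (vP F k s n) = if n % 3 = 2 then vP F k s (n + 3) else 0 := by
    intro n
    simp only [hf, Module.End.mul_apply, op_vP c hk]
    split_ifs with h <;> simp [op_vP c hk, Nat.add_mod, h]
  have fS : ∀ n, f (vS F k s n) = 0 := by
    intro n
    simp [hf, Module.End.mul_apply, op_vS]
  have hS : ∀ j n, (op F k s c .h ^ j) (vS F k s n) = vS F k s (n + j) := by
    intro j
    induction j with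
    | zero => simp
    | succ j ih => intro n; rw [pow_succ', Module.End.mul_apply, ih, op_vS]; rfl
  have hpow : ∀ v, op F k s c .h v = 0 → (op F k s c .h ^ s) v = 0 := by
    intro v hv
    rw [← pow_sub_mul_pow _ hs, pow_one, Module.End.mul_apply, hv, map_zero]
  refine model_ext (fun n => ?_) (fun n => ?_) (fun n => ?_) (fun n => ?_)
  · rw [hpow _ (op_vP c hk _ _), pow_shift fP hk0]
    split_ifs with h
    · exact (vP_eq_zero (by omega)).symm
    · rfl
  · rw [hpow _ (op_vQ c _ _), pow_shift fQ hk0, vQ_eq_zero (by omega), ite_self]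
  · rw [pow_shift fR hk0]
    rcases eq_or_ne n 0 with rfl | h0
    · rw [if_pos rfl, zero_add, vR_top]
      rw [← pow_sub_mul_pow _ hs, pow_one, Module.End.mul_apply, op_vR c hk hs]
      simp only [if_true]
      rw [hS, zero_add]
    · rw [hpow _ (by simp [op_vR c hk hs, h0]), vR_eq_zero (by omega), ite_self]
  · rw [hS, vS_eq_zero (by omega)]
    obtain ⟨j, rfl⟩ : ∃ j, k = j + 1 := ⟨k - 1, by omega⟩
    rw [pow_succ, Module.End.mul_apply, fS, map_zero]

/-- The generators act on the model through the relations of `DA`. -/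
lemma lift_op_rel (hk : 1 ≤ k) (hs : 1 ≤ s) {x y : FreeAlgebra F Gen} (h : Rel F k s c x y) :
    FreeAlgebra.lift F (op F k s c) x = FreeAlgebra.lift F (op F k s c) y := by
  obtain ⟨hP0, hP, hQ, hR, hS⟩ := abg_pow_op (F := F) c hk hs
  have h3 : (3 * k - 1) % 3 = 2 := by omega
  have h4 : 3 * k - 1 + 1 = 3 * k := by omega
  cases h <;> simp only [gen, map_add, map_mul, map_pow, map_smul, map_one, map_zero,
    FreeAlgebra.lift_ι_apply]
  case hs => exact eta_pow_op c hk hs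
  case abg => exact (bga_pow_op c hk hs).symm
  case asq =>
    refine model_ext (fun n => ?_) (fun n => ?_) (fun n => ?_) (fun n => ?_)
    · rcases eq_or_ne n 0 with rfl | h0
      · simp [hP0, op_vP c hk]
      · rw [LinearMap.smul_apply, hP n h0, Module.End.mul_apply, op_vP c hk]
        by_cases h : n % 3 = 0
        · have : (n + 1) % 3 = 1 := by omega
          simp [op_vP c hk, h, h0, this]
        · by_cases h1 : n = 1 <;> simp [h, h1, op_vQ, h3]
    · rw [LinearMap.smul_apply, hQ, Module.End.mul_apply, op_vQ]
      by_cases h : n % 3 = 1 <;> simp [op_vQ, h, Nat.add_mod]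
    · rw [LinearMap.smul_apply, hR, Module.End.mul_apply, op_vR c hk hs]
      by_cases h : n % 3 = 1 <;> simp [op_vR c hk hs, h, Nat.add_mod]
    · simp [hS, op_vS]
  all_goals
    clear hP0 hP hQ hR hS h4
    refine model_ext (fun n => ?_) (fun n => ?_) (fun n => ?_) (fun n => ?_)
    · simp only [LinearMap.add_apply, Module.End.mul_apply, Module.End.one_apply,
        LinearMap.zero_apply, op_vP c hk]
      have : n % 3 < 3 := Nat.mod_lt _ (by norm_num)
      interval_cases h : n % 3 <;> by_cases h0 : n = 0 <;> by_cases h1 : n = 1 <;>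
        simp_all [op_vP c hk, op_vQ, Nat.add_mod]
    · simp only [LinearMap.add_apply, Module.End.mul_apply, Module.End.one_apply,
        LinearMap.zero_apply, op_vQ]
      have : n % 3 < 3 := Nat.mod_lt _ (by norm_num)
      interval_cases h : n % 3 <;> simp_all [op_vQ, Nat.add_mod]
    · simp only [LinearMap.add_apply, Module.End.mul_apply, Module.End.one_apply,
        LinearMap.zero_apply, op_vR c hk hs]
      have : n % 3 < 3 := Nat.mod_lt _ (by norm_num)
      interval_cases h : n % 3 <;> by_cases h0 : n = 0 <;>
        simp_all [op_vR c hk hs, op_vS, Nat.add_mod]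
    · simp [op_vS]

end Model

/-! ### Chains of paths in the algebra -/

section Chains

/-- The chain `v, x v, y x v, z y x v, x z y x v, …`. -/
def chain {A : Type} [Monoid A] (x y z v : A) : ℕ → A
  | 0 => v
  | n + 1 => (if n % 3 = 0 then x else if n % 3 = 1 then y else z) * chain x y z v n

section General

variable {A : Type} [Monoid A] (x y z v : A) (m : ℕ)

lemma chain_three_mul : chain x y z v (3 * m) = (z * y * x) ^ m * v := by
  induction m with
  | zero => simp [chain]
  | succ m ih =>
    have h1 : (3 * m + 1) % 3 = 1 := by omega
    have h2 : (3 * m + 2) % 3 = 2 := by omega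
    simp [Nat.mul_succ, chain, ih, h1, h2, pow_succ', mul_assoc]

lemma chain_three_mul_add_one : chain x y z v (3 * m + 1) = (x * z * y) ^ m * (x * v) := by
  have h : (x * z * y) ^ m * x = x * (z * y * x) ^ m := by
    have : SemiconjBy x (z * y * x) (x * z * y) := by simp [SemiconjBy, mul_assoc]
    exact ((this.pow_right m).eq).symm
  simp [chain, chain_three_mul, ← mul_assoc, h]

lemma chain_three_mul_add_two :
    chain x y z v (3 * m + 2) = (y * x * z) ^ m * (y * (x * v)) := by
  have h : (y * x * z) ^ m * y = y * (x * z * y) ^ m := by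
    have : SemiconjBy y (x * z * y) (y * x * z) := by simp [SemiconjBy, mul_assoc]
    exact ((this.pow_right m).eq).symm
  have h1 : (3 * m + 1) % 3 = 1 := by omega
  rw [chain, chain_three_mul_add_one]
  simp [h1, ← mul_assoc, h]

end General

/-- The chain `e₁, α, γα, βγα, …`. -/
def cP : ℕ → DA F k s c := chain (Al F k s c) (Ga F k s c) (Be F k s c) (E1 F k s c)
/-- The chain `e₁, γ, βγ, αβγ, …`. -/
def cQ : ℕ → DA F k s c := chain (Ga F k s c) (Be F k s c) (Al F k s c) (E1 F k s c)
/-- The chain `e₂, β, αβ, γαβ, …`. -/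
def cR : ℕ → DA F k s c := chain (Be F k s c) (Al F k s c) (Ga F k s c) (E2 F k s c)

/-- The family of standard basis paths, indexed by their labels. -/
def path : Idx k s → DA F k s c
  | .inl n => cP F k s c n
  | .inr (.inl n) => cQ F k s c (n + 1)
  | .inr (.inr (.inl n)) => cR F k s c n
  | .inr (.inr (.inr n)) => Et F k s c ^ (n.1 + 1)

variable {F k s c}

lemma mk_rel {x y : FreeAlgebra F Gen} (h : Rel F k s c x y) : mk F k s c x = mk F k s c y :=
  RingQuot.mkAlgHom_rel F h

lemma e1_add_e2 : E1 F k s c + E2 F k s c = 1 := by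
  simpa [E1, E2] using mk_rel (k := k) (s := s) (c := c) .unit

/-- The idempotent at which a generator starts. -/
def source : Gen → Gen
  | .e1 | .a | .b => .e1
  | .e2 | .g | .h => .e2

/-- The idempotent at which a generator ends. -/
def target : Gen → Gen
  | .e1 | .a | .g => .e1
  | .e2 | .b | .h => .e2

lemma source_mul (t : Gen) :
    mk F k s c (gen F (source t)) * mk F k s c (gen F t) = mk F k s c (gen F t) := by
  rw [← map_mul]
  cases t
  exacts [mk_rel .idem1, mk_rel .idem2, mk_rel .aL, mk_rel .bL, mk_rel .gL, mk_rel .hL]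

lemma mul_target (t : Gen) :
    mk F k s c (gen F t) * mk F k s c (gen F (target t)) = mk F k s c (gen F t) := by
  rw [← map_mul]
  cases t
  exacts [mk_rel .idem1, mk_rel .idem2, mk_rel .aR, mk_rel .bR, mk_rel .gR, mk_rel .hR]

lemma mul_eq_zero_of_target_ne {t u : Gen} (h : target t ≠ source u) :
    mk F k s c (gen F t) * mk F k s c (gen F u) = 0 := by
  have h12 : mk F k s c (gen F .e1) * mk F k s c (gen F .e2) = 0 := by
    simpa using mk_rel (k := k) (s := s) (c := c) .orth12
  have h21 : mk F k s c (gen F .e2) * mk F k s c (gen F .e1) = 0 := by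
    simpa using mk_rel (k := k) (s := s) (c := c) .orth21
  rw [← mul_target t, ← source_mul u, mul_assoc, ← mul_assoc (mk F k s c (gen F (target t)))]
  cases t <;> cases u <;> simp_all [source, target]

lemma al_e1 : Al F k s c * E1 F k s c = Al F k s c := mul_target .a
lemma ga_e1 : Ga F k s c * E1 F k s c = Ga F k s c := mul_target .g
lemma be_e2 : Be F k s c * E2 F k s c = Be F k s c := mul_target .b
lemma et_e2 : Et F k s c * E2 F k s c = Et F k s c := mul_target .h

lemma be_et : Be F k s c * Et F k s c = 0 := by
  simpa [Be, Et] using mk_rel (k := k) (s := s) (c := c) .bh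

lemma et_ga : Et F k s c * Ga F k s c = 0 := by
  simpa [Et, Ga] using mk_rel (k := k) (s := s) (c := c) .hg

lemma ga_be : Ga F k s c * Be F k s c = 0 := by
  simpa [Ga, Be] using mk_rel (k := k) (s := s) (c := c) .gb

lemma al_al : Al F k s c * Al F k s c = c • ABG F k s c ^ k := by
  simpa [Al, Be, Ga, ABG] using mk_rel (k := k) (s := s) (c := c) .asq

lemma abg_pow : ABG F k s c ^ k = BGA F k s c ^ k := by
  simpa [Al, Be, Ga, ABG, BGA] using mk_rel (k := k) (s := s) (c := c) .abg

lemma et_pow : Et F k s c ^ s = GAB F k s c ^ k := by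
  simpa [Al, Be, Ga, Et, GAB] using mk_rel (k := k) (s := s) (c := c) .hs

lemma al_al_be (hk : 1 ≤ k) : Al F k s c * Al F k s c * Be F k s c = 0 := by
  have h : ABG F k s c ^ k * Be F k s c = 0 := by
    rw [← pow_sub_mul_pow _ hk, pow_one, ABG]
    simp only [mul_assoc, ga_be, mul_zero]
  rw [al_al, smul_mul_assoc, h, smul_zero]

lemma cP_three_mul {i : ℕ} (hi : i ≠ 0) : cP F k s c (3 * i) = BGA F k s c ^ i := by
  obtain ⟨j, rfl⟩ := Nat.exists_eq_succ_of_ne_zero hi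
  rw [cP, chain_three_mul, pow_succ, mul_assoc, mul_assoc _ _ (E1 F k s c), al_e1,
    Nat.succ_eq_add_one, pow_succ]
  rfl

lemma cQ_three_mul {i : ℕ} (hi : i ≠ 0) : cQ F k s c (3 * i) = ABG F k s c ^ i := by
  obtain ⟨j, rfl⟩ := Nat.exists_eq_succ_of_ne_zero hi
  rw [cQ, chain_three_mul, pow_succ, mul_assoc, mul_assoc _ _ (E1 F k s c), ga_e1,
    Nat.succ_eq_add_one, pow_succ]
  rfl

lemma cR_three_mul {i : ℕ} (hi : i ≠ 0) : cR F k s c (3 * i) = GAB F k s c ^ i := by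
  obtain ⟨j, rfl⟩ := Nat.exists_eq_succ_of_ne_zero hi
  rw [cR, chain_three_mul, pow_succ, mul_assoc, mul_assoc _ _ (E2 F k s c), be_e2,
    Nat.succ_eq_add_one, pow_succ]
  rfl

lemma cP_three_mul_add_one (i : ℕ) : cP F k s c (3 * i + 1) = ABG F k s c ^ i * Al F k s c := by
  rw [cP, chain_three_mul_add_one, al_e1, ABG]

lemma cQ_three_mul_add_one (i : ℕ) : cQ F k s c (3 * i + 1) = GAB F k s c ^ i * Ga F k s c := by
  rw [cQ, chain_three_mul_add_one, ga_e1, GAB]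

lemma cR_three_mul_add_one (i : ℕ) : cR F k s c (3 * i + 1) = BGA F k s c ^ i * Be F k s c := by
  rw [cR, chain_three_mul_add_one, be_e2, BGA]

lemma cP_three_mul_add_two (i : ℕ) :
    cP F k s c (3 * i + 2) = GAB F k s c ^ i * (Ga F k s c * Al F k s c) := by
  rw [cP, chain_three_mul_add_two, al_e1, GAB]

lemma cQ_three_mul_add_two (i : ℕ) :
    cQ F k s c (3 * i + 2) = BGA F k s c ^ i * (Be F k s c * Ga F k s c) := by
  rw [cQ, chain_three_mul_add_two, ga_e1, BGA]

lemma cR_three_mul_add_two (i : ℕ) :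
    cR F k s c (3 * i + 2) = ABG F k s c ^ i * (Al F k s c * Be F k s c) := by
  rw [cR, chain_three_mul_add_two, be_e2, ABG]

/-! ### The paths span -/

lemma chain_eq_zero {A : Type} [MonoidWithZero A] {x y z v : A} {N n : ℕ}
    (hN : chain x y z v N = 0) (h : N ≤ n) : chain x y z v n = 0 := by
  induction n, h using Nat.le_induction with
  | base => exact hN
  | succ n _ ih => rw [chain, ih, mul_zero]

lemma cP_eq_zero (hk : 1 ≤ k) {n : ℕ} (h : 3 * k < n) : cP F k s c n = 0 := by
  refine chain_eq_zero (N := 3 * k + 1) ?_ h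
  have h0 : chain (Al F k s c) (Ga F k s c) (Be F k s c) (E1 F k s c) (3 * k) = _ :=
    cP_three_mul (by omega)
  rw [chain, h0, if_pos (by omega), ← abg_pow, ← mul_pow_sub_one (by omega), ABG]
  simp only [← mul_assoc]
  rw [al_al_be hk]
  simp

lemma cQ_eq_zero (hs : 1 ≤ s) {n : ℕ} (h : 3 * k < n) : cQ F k s c n = 0 := by
  refine chain_eq_zero (N := 3 * k + 1) ?_ h
  have h0 : chain (Ga F k s c) (Be F k s c) (Al F k s c) (E1 F k s c) (3 * k + 1) = _ :=
    cQ_three_mul_add_one k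
  rw [h0, ← et_pow, ← pow_sub_mul_pow _ hs, pow_one, mul_assoc, et_ga, mul_zero]

lemma cR_eq_zero (hk : 1 ≤ k) (hs : 1 ≤ s) {n : ℕ} (h : 3 * k < n) : cR F k s c n = 0 := by
  refine chain_eq_zero (N := 3 * k + 1) ?_ h
  have h0 : chain (Be F k s c) (Al F k s c) (Ga F k s c) (E2 F k s c) (3 * k) = _ :=
    cR_three_mul (by omega)
  rw [chain, h0, if_pos (by omega), ← et_pow, ← mul_pow_sub_one (by omega), ← mul_assoc, be_et,
    zero_mul]

lemma et_pow_eq_zero (hk : 1 ≤ k) {n : ℕ} (h : s < n) : Et F k s c ^ n = 0 := by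
  have h0 : Et F k s c ^ (s + 1) = 0 := by
    rw [pow_succ, et_pow, ← pow_sub_mul_pow _ hk, pow_one, GAB]
    simp only [mul_assoc, be_et, mul_zero]
  exact pow_eq_zero_of_le h h0

lemma cP_mem_range {n : ℕ} (h : n < 3 * k) : cP F k s c n ∈ Set.range (path F k s c) :=
  ⟨.inl ⟨n, h⟩, rfl⟩

lemma cQ_mem_range {n : ℕ} (h0 : 0 < n) (h : n ≤ 3 * k) :
    cQ F k s c n ∈ Set.range (path F k s c) := by
  obtain ⟨m, rfl⟩ := Nat.exists_eq_succ_of_ne_zero h0.ne'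
  exact ⟨.inr (.inl ⟨m, h⟩), rfl⟩

lemma cR_mem_range {n : ℕ} (h : n < 3 * k) : cR F k s c n ∈ Set.range (path F k s c) :=
  ⟨.inr (.inr (.inl ⟨n, h⟩)), rfl⟩

lemma et_pow_mem_range {n : ℕ} (h0 : 0 < n) (h : n ≤ s) :
    Et F k s c ^ n ∈ Set.range (path F k s c) := by
  obtain ⟨m, rfl⟩ := Nat.exists_eq_succ_of_ne_zero h0.ne'
  exact ⟨.inr (.inr (.inr ⟨m, h⟩)), rfl⟩

section Span

variable (F k s c) in
/-- The linear span of the standard basis paths. -/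
abbrev pathSpan : Submodule F (DA F k s c) := Submodule.span F (Set.range (path F k s c))

lemma cQ_mem_span (hk : 1 ≤ k) (hs : 1 ≤ s) (n : ℕ) : cQ F k s c n ∈ pathSpan F k s c := by
  rcases Nat.eq_zero_or_pos n with rfl | h0
  · exact Submodule.subset_span (cP_mem_range (n := 0) (by omega))
  · rcases le_or_gt n (3 * k) with h | h
    · exact Submodule.subset_span (cQ_mem_range h0 h)
    · rw [cQ_eq_zero hs h]
      exact Submodule.zero_mem _

lemma cP_mem_span (hk : 1 ≤ k) (hs : 1 ≤ s) (n : ℕ) : cP F k s c n ∈ pathSpan F k s c := by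
  rcases lt_trichotomy n (3 * k) with h | rfl | h
  · exact Submodule.subset_span (cP_mem_range h)
  · rw [cP_three_mul (by omega), ← abg_pow, ← cQ_three_mul (by omega)]
    exact cQ_mem_span hk hs _
  · rw [cP_eq_zero hk h]
    exact Submodule.zero_mem _

lemma et_pow_mem_span (hk : 1 ≤ k) {n : ℕ} (h0 : 0 < n) : Et F k s c ^ n ∈ pathSpan F k s c := by
  rcases le_or_gt n s with h | h
  · exact Submodule.subset_span (et_pow_mem_range h0 h)
  · rw [et_pow_eq_zero hk h]
    exact Submodule.zero_mem _

lemma cR_mem_span (hk : 1 ≤ k) (hs : 1 ≤ s) (n : ℕ) : cR F k s c n ∈ pathSpan F k s c := by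
  rcases lt_trichotomy n (3 * k) with h | rfl | h
  · exact Submodule.subset_span (cR_mem_range h)
  · rw [cR_three_mul (by omega), ← et_pow]
    exact et_pow_mem_span hk hs
  · rw [cR_eq_zero hk hs h]
    exact Submodule.zero_mem _

lemma al_al_mem_span (hk : 1 ≤ k) (hs : 1 ≤ s) : Al F k s c * Al F k s c ∈ pathSpan F k s c := by
  rw [al_al, ← cQ_three_mul (by omega)]
  exact Submodule.smul_mem _ _ (cQ_mem_span hk hs _)

/-- Criterion for the span to contain every product of a generator with a path beginning with `α`. -/
lemma mul_al_mul_mem_span {x : DA F k s c} (h1 : Al F k s c * x ∈ pathSpan F k s c)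
    (h2 : Ga F k s c * (Al F k s c * x) ∈ pathSpan F k s c) (h3 : Al F k s c * Al F k s c * x ∈ pathSpan F k s c) (t : Gen) :
    mk F k s c (gen F t) * (Al F k s c * x) ∈ pathSpan F k s c := by
  rw [← mul_assoc] at h2 ⊢
  cases t
  · exact (source_mul (F := F) (k := k) (s := s) (c := c) .a).symm ▸ h1
  · rw [Al, mul_eq_zero_of_target_ne (by simp [source, target]), zero_mul]; exact zero_mem _
  · exact h3
  · rw [Al, mul_eq_zero_of_target_ne (by simp [source, target]), zero_mul]; exact zero_mem _
  · exact h2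
  · rw [Al, mul_eq_zero_of_target_ne (by simp [source, target]), zero_mul]; exact zero_mem _

/-- Criterion for the span to contain every product of a generator with a path beginning with `β`. -/
lemma mul_be_mul_mem_span {x : DA F k s c} (h1 : Be F k s c * x ∈ pathSpan F k s c)
    (h2 : Al F k s c * (Be F k s c * x) ∈ pathSpan F k s c) (t : Gen) :
    mk F k s c (gen F t) * (Be F k s c * x) ∈ pathSpan F k s c := by
  rw [← mul_assoc] at h2 ⊢
  cases t
  · exact (source_mul (F := F) (k := k) (s := s) (c := c) .b).symm ▸ h1
  · rw [Be, mul_eq_zero_of_target_ne (by simp [source, target]), zero_mul]; exact zero_mem _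
  · exact h2
  · rw [Be, mul_eq_zero_of_target_ne (by simp [source, target]), zero_mul]; exact zero_mem _
  · exact (ga_be (F := F) (k := k) (s := s) (c := c)).symm ▸ by simp
  · rw [Be, mul_eq_zero_of_target_ne (by simp [source, target]), zero_mul]; exact zero_mem _

/-- Criterion for the span to contain every product of a generator with a path beginning with `γ`. -/
lemma mul_ga_mul_mem_span {x : DA F k s c} (h1 : Ga F k s c * x ∈ pathSpan F k s c)
    (h2 : Be F k s c * (Ga F k s c * x) ∈ pathSpan F k s c) (t : Gen) :
    mk F k s c (gen F t) * (Ga F k s c * x) ∈ pathSpan F k s c := by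
  rw [← mul_assoc] at h2 ⊢
  cases t
  · rw [Ga, mul_eq_zero_of_target_ne (by simp [source, target]), zero_mul]; exact zero_mem _
  · exact (source_mul (F := F) (k := k) (s := s) (c := c) .g).symm ▸ h1
  · rw [Ga, mul_eq_zero_of_target_ne (by simp [source, target]), zero_mul]; exact zero_mem _
  · exact h2
  · rw [Ga, mul_eq_zero_of_target_ne (by simp [source, target]), zero_mul]; exact zero_mem _
  · exact (et_ga (F := F) (k := k) (s := s) (c := c)).symm ▸ by simp

lemma mul_et_pow_mem_span (hk : 1 ≤ k) (n : ℕ) (t : Gen) :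
    mk F k s c (gen F t) * Et F k s c ^ (n + 1) ∈ pathSpan F k s c := by
  have h1 : Et F k s c * Et F k s c ^ n ∈ pathSpan F k s c :=
    pow_succ' (Et F k s c) n ▸ et_pow_mem_span hk n.succ_pos
  have h2 : Et F k s c * Et F k s c * Et F k s c ^ n ∈ pathSpan F k s c := by
    rw [mul_assoc, ← pow_succ', ← pow_succ']
    exact et_pow_mem_span hk (by omega)
  rw [pow_succ', ← mul_assoc]
  cases t
  · rw [Et, mul_eq_zero_of_target_ne (by simp [source, target]), zero_mul]; exact zero_mem _
  · exact (source_mul (F := F) (k := k) (s := s) (c := c) .h).symm ▸ h1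
  · rw [Et, mul_eq_zero_of_target_ne (by simp [source, target]), zero_mul]; exact zero_mem _
  · exact (be_et (F := F) (k := k) (s := s) (c := c)).symm ▸ by simp
  · rw [Et, mul_eq_zero_of_target_ne (by simp [source, target]), zero_mul]; exact zero_mem _
  · exact h2

lemma mul_e1_mem_span (hk : 1 ≤ k) (hs : 1 ≤ s) (t : Gen) :
    mk F k s c (gen F t) * E1 F k s c ∈ pathSpan F k s c := by
  cases t
  · exact (mul_target (F := F) (k := k) (s := s) (c := c) .e1).symm ▸ cP_mem_span hk hs 0
  · rw [E1, mul_eq_zero_of_target_ne (by simp [source, target])]; exact zero_mem _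
  · exact cP_mem_span hk hs 1
  · rw [E1, mul_eq_zero_of_target_ne (by simp [source, target])]; exact zero_mem _
  · exact cQ_mem_span hk hs 1
  · rw [E1, mul_eq_zero_of_target_ne (by simp [source, target])]; exact zero_mem _

lemma mul_e2_mem_span (hk : 1 ≤ k) (hs : 1 ≤ s) (t : Gen) :
    mk F k s c (gen F t) * E2 F k s c ∈ pathSpan F k s c := by
  cases t
  · rw [E2, mul_eq_zero_of_target_ne (by simp [source, target])]; exact zero_mem _
  · exact (mul_target (F := F) (k := k) (s := s) (c := c) .e2).symm ▸ cR_mem_span hk hs 0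
  · rw [E2, mul_eq_zero_of_target_ne (by simp [source, target])]; exact zero_mem _
  · exact cR_mem_span hk hs 1
  · rw [E2, mul_eq_zero_of_target_ne (by simp [source, target])]; exact zero_mem _
  · rw [show mk F k s c (gen F .h) * E2 F k s c = Et F k s c ^ 1 by rw [pow_one]; exact et_e2]
    exact et_pow_mem_span hk one_pos

lemma cP_succ (n : ℕ) : cP F k s c (n + 1) = (if n % 3 = 0 then Al F k s c
    else if n % 3 = 1 then Ga F k s c else Be F k s c) * cP F k s c n := rfl

lemma cQ_succ (n : ℕ) : cQ F k s c (n + 1) = (if n % 3 = 0 then Ga F k s c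
    else if n % 3 = 1 then Be F k s c else Al F k s c) * cQ F k s c n := rfl

lemma cR_succ (n : ℕ) : cR F k s c (n + 1) = (if n % 3 = 0 then Be F k s c
    else if n % 3 = 1 then Al F k s c else Ga F k s c) * cR F k s c n := rfl

lemma mul_cP_mem_span (hk : 1 ≤ k) (hs : 1 ≤ s) (t : Gen) (n : ℕ) :
    mk F k s c (gen F t) * cP F k s c n ∈ pathSpan F k s c := by
  rcases n with _ | n
  · exact mul_e1_mem_span hk hs t
  have h1 := cP_mem_span (F := F) (c := c) hk hs (n + 1)
  have h2 := cP_mem_span (F := F) (c := c) hk hs (n + 2)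
  rw [cP_succ, cP_succ] at h2
  rw [cP_succ] at h1 ⊢
  have h : n % 3 = 0 ∨ n % 3 = 1 ∨ n % 3 = 2 := by omega
  rcases h with h | h | h <;> simp only [h, Nat.add_mod n 1 3] at h1 h2 ⊢
  · refine mul_al_mul_mem_span h1 h2 ?_ t
    rcases n with _ | n
    · rw [show cP F k s c 0 = E1 F k s c from rfl, mul_assoc, al_e1]
      exact al_al_mem_span hk hs
    · rw [cP_succ, if_neg (by omega), if_neg (by omega), ← mul_assoc, al_al_be hk, zero_mul]
      exact zero_mem _
  · exact mul_ga_mul_mem_span h1 h2 t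
  · exact mul_be_mul_mem_span h1 h2 t

lemma mul_cQ_mem_span (hk : 1 ≤ k) (hs : 1 ≤ s) (t : Gen) (n : ℕ) :
    mk F k s c (gen F t) * cQ F k s c n ∈ pathSpan F k s c := by
  rcases n with _ | n
  · exact mul_e1_mem_span hk hs t
  have h1 := cQ_mem_span (F := F) (c := c) hk hs (n + 1)
  have h2 := cQ_mem_span (F := F) (c := c) hk hs (n + 2)
  rw [cQ_succ, cQ_succ] at h2
  rw [cQ_succ] at h1 ⊢
  have h : n % 3 = 0 ∨ n % 3 = 1 ∨ n % 3 = 2 := by omega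
  rcases h with h | h | h <;> simp only [h, Nat.add_mod n 1 3] at h1 h2 ⊢
  · exact mul_ga_mul_mem_span h1 h2 t
  · exact mul_be_mul_mem_span h1 h2 t
  · refine mul_al_mul_mem_span h1 h2 ?_ t
    rcases n with _ | n
    · simp at h
    · rw [cQ_succ, if_neg (by omega), if_pos (by omega), ← mul_assoc, al_al_be hk, zero_mul]
      exact zero_mem _

lemma mul_cR_mem_span (hk : 1 ≤ k) (hs : 1 ≤ s) (t : Gen) (n : ℕ) :
    mk F k s c (gen F t) * cR F k s c n ∈ pathSpan F k s c := by
  rcases n with _ | n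
  · exact mul_e2_mem_span hk hs t
  have h1 := cR_mem_span (F := F) (c := c) hk hs (n + 1)
  have h2 := cR_mem_span (F := F) (c := c) hk hs (n + 2)
  rw [cR_succ, cR_succ] at h2
  rw [cR_succ] at h1 ⊢
  have h : n % 3 = 0 ∨ n % 3 = 1 ∨ n % 3 = 2 := by omega
  rcases h with h | h | h <;> simp only [h, Nat.add_mod n 1 3] at h1 h2 ⊢
  · exact mul_be_mul_mem_span h1 h2 t
  · refine mul_al_mul_mem_span h1 h2 ?_ t
    rcases n with _ | n
    · simp at h
    · rw [cR_succ, if_pos (by omega), ← mul_assoc, al_al_be hk, zero_mul]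
      exact zero_mem _
  · exact mul_ga_mul_mem_span h1 h2 t

lemma span_range_path (hk : 1 ≤ k) (hs : 1 ≤ s) : pathSpan F k s c = ⊤ := by
  have hgen : ∀ (t : Gen), ∀ w ∈ pathSpan F k s c, mk F k s c (gen F t) * w ∈ pathSpan F k s c := by
    intro t w hw
    induction hw using Submodule.span_induction with
    | mem _ h =>
      obtain ⟨i | i | i | i, rfl⟩ := h
      exacts [mul_cP_mem_span hk hs t _, mul_cQ_mem_span hk hs t _, mul_cR_mem_span hk hs t _,
        mul_et_pow_mem_span hk _ t]
    | zero => simp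
    | add x y _ _ hx hy => rw [mul_add]; exact add_mem hx hy
    | smul r x _ hx => rw [mul_smul_comm]; exact Submodule.smul_mem _ _ hx
  have hall : ∀ (x : FreeAlgebra F Gen), ∀ w ∈ pathSpan F k s c, mk F k s c x * w ∈ pathSpan F k s c := by
    intro x
    induction x using FreeAlgebra.induction with
    | grade0 r =>
      intro w hw
      rw [AlgHom.commutes, ← Algebra.smul_def]
      exact Submodule.smul_mem _ _ hw
    | grade1 t => exact hgen t
    | mul x y hx hy => intro w hw; rw [map_mul, mul_assoc]; exact hx _ (hy _ hw)
    | add x y hx hy => intro w hw; rw [map_add, add_mul]; exact add_mem (hx _ hw) (hy _ hw)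
  refine eq_top_iff.2 fun x _ => ?_
  obtain ⟨y, rfl⟩ := RingQuot.mkAlgHom_surjective F (Rel F k s c) x
  have h1 : (1 : DA F k s c) ∈ pathSpan F k s c := by
    rw [← e1_add_e2]
    exact add_mem (cP_mem_span hk hs 0) (cR_mem_span hk hs 0)
  exact mul_one (mk F k s c y) ▸ hall y 1 h1

end Span

/-! ### The paths are linearly independent -/

/-- The representation of `DA` on the model. -/
def rep (hk : 1 ≤ k) (hs : 1 ≤ s) : DA F k s c →ₐ[F] Module.End F (Idx k s →₀ F) :=
  RingQuot.liftAlgHom F ⟨FreeAlgebra.lift F (op F k s c), fun _ _ h => lift_op_rel c hk hs h⟩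

lemma rep_gen (hk : 1 ≤ k) (hs : 1 ≤ s) (t : Gen) :
    rep hk hs (mk F k s c (gen F t)) = op F k s c t := by
  refine (RingQuot.liftAlgHom_mkAlgHom_apply F _ _ _).trans ?_
  simp [gen]

/-- The action on the element of the model representing `1`. -/
def toModel (hk : 1 ≤ k) (hs : 1 ≤ s) : DA F k s c →ₗ[F] (Idx k s →₀ F) :=
  (LinearMap.applyₗ (vP F k s 0 + vR F k s 0)).comp (rep hk hs).toLinearMap

section

variable (hk : 1 ≤ k) (hs : 1 ≤ s)

lemma toModel_gen (t : Gen) : toModel hk hs (mk F k s c (gen F t)) =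
    op F k s c t (vP F k s 0) + op F k s c t (vR F k s 0) := by
  simp [toModel, rep_gen]

lemma toModel_gen_mul (t : Gen) (x : DA F k s c) :
    toModel hk hs (mk F k s c (gen F t) * x) = op F k s c t (toModel hk hs x) := by
  simp [toModel, rep_gen]

lemma toModel_cP (n : ℕ) : toModel hk hs (cP F k s c n) = vP F k s n := by
  induction n with
  | zero =>
    rw [show cP F k s c 0 = mk F k s c (gen F .e1) from rfl, toModel_gen]
    simp [op_vP c hk, op_vR c hk hs]
  | succ n ih =>
    rw [cP_succ, Al, Be, Ga]
    split_ifs with h h' <;> rw [toModel_gen_mul, ih, op_vP c hk]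
    · simp [h]
    · have : n ≠ 0 := by omega
      simp [this, h']
    · have : n % 3 = 2 := by omega
      simp [this]

lemma toModel_cQ (n : ℕ) : toModel hk hs (cQ F k s c (n + 1)) = vQ F k s n := by
  induction n with
  | zero =>
    rw [show cQ F k s c (0 + 1) = mk F k s c (gen F .g) from ga_e1, toModel_gen]
    simp [op_vP c hk, op_vR c hk hs]
  | succ n ih =>
    rw [cQ_succ, Al, Be, Ga]
    split_ifs with h h' <;> rw [toModel_gen_mul, ih, op_vQ] <;> exact if_pos (by omega)

lemma toModel_cR (n : ℕ) : toModel hk hs (cR F k s c n) = vR F k s n := by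
  induction n with
  | zero =>
    rw [show cR F k s c 0 = mk F k s c (gen F .e2) from rfl, toModel_gen]
    simp [op_vP c hk, op_vR c hk hs]
  | succ n ih =>
    rw [cR_succ, Al, Be, Ga]
    split_ifs with h h' <;> rw [toModel_gen_mul, ih, op_vR c hk hs] <;> exact if_pos (by omega)

lemma toModel_et_pow (n : ℕ) : toModel hk hs (Et F k s c ^ (n + 1)) = vS F k s n := by
  induction n with
  | zero =>
    rw [zero_add, pow_one, Et, toModel_gen]
    simp [op_vP c hk, op_vR c hk hs]
  | succ n ih =>
    rw [pow_succ', Et, toModel_gen_mul, ← Et, ih, op_vS]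

lemma toModel_path (i : Idx k s) : toModel hk hs (path F k s c i) = Finsupp.single i 1 := by
  rcases i with i | i | i | i
  · exact (toModel_cP hk hs _).trans (vP_of_lt i.2)
  · exact (toModel_cQ hk hs _).trans (vQ_of_lt i.2)
  · exact (toModel_cR hk hs _).trans (vR_of_lt i.2)
  · exact (toModel_et_pow hk hs _).trans (vS_of_lt i.2)

end

lemma linearIndependent_path (hk : 1 ≤ k) (hs : 1 ≤ s) :
    LinearIndependent F (path F k s c) := by
  refine LinearIndependent.of_comp (toModel hk hs) ?_
  have : toModel hk hs ∘ path F k s c = fun i => Finsupp.single i (1 : F) :=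
    funext (toModel_path hk hs)
  rw [this]
  exact Finsupp.linearIndependent_single_one F (Idx k s)

/-! ### The set of standard basis paths -/

lemma BB_subset_range (hk : 1 ≤ k) : BB F k s c ⊆ Set.range (path F k s c) := by
  rintro x (((hx | hx) | hx) | hx)
  · rcases hx with (((hx | ⟨i, hi, rfl⟩) | ⟨i, hi, rfl⟩) | ⟨i, hi, rfl⟩) | ⟨i, hi, rfl⟩
    · rcases hx with rfl | rfl | rfl | rfl
      · exact cP_mem_range (n := 0) (by omega)
      · have := cP_three_mul_add_one (F := F) (k := k) (s := s) (c := c) 0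
        rw [pow_zero, one_mul] at this
        rw [← this]; exact cP_mem_range (by omega)
      · have := cQ_three_mul_add_two (F := F) (k := k) (s := s) (c := c) 0
        rw [pow_zero, one_mul] at this
        rw [← this]; exact cQ_mem_range (by omega) (by omega)
      · rw [← cQ_three_mul (by omega)]; exact cQ_mem_range (by omega) le_rfl
    all_goals obtain ⟨h1, h2⟩ := hi; dsimp only
    · rw [← cQ_three_mul (by omega)]; exact cQ_mem_range (by omega) (by omega)
    · rw [← cP_three_mul_add_one]; exact cP_mem_range (by omega)
    · rw [← cP_three_mul (by omega)]; exact cP_mem_range (by omega)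
    · rw [← cQ_three_mul_add_two]; exact cQ_mem_range (by omega) (by omega)
  · rcases hx with (hx | ⟨i, hi, rfl⟩) | ⟨i, hi, rfl⟩
    · rcases hx with rfl | rfl
      · have := cR_three_mul_add_one (F := F) (k := k) (s := s) (c := c) 0
        rw [pow_zero, one_mul] at this
        rw [← this]; exact cR_mem_range (by omega)
      · have := cR_three_mul_add_two (F := F) (k := k) (s := s) (c := c) 0
        rw [pow_zero, one_mul] at this
        rw [← this]; exact cR_mem_range (by omega)
    all_goals obtain ⟨h1, h2⟩ := hi; dsimp only
    · rw [← cR_three_mul_add_one]; exact cR_mem_range (by omega)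
    · rw [← cR_three_mul_add_two]; exact cR_mem_range (by omega)
  · rcases hx with (hx | ⟨i, hi, rfl⟩) | ⟨i, hi, rfl⟩
    · rcases hx with rfl | rfl
      · have := cQ_three_mul_add_one (F := F) (k := k) (s := s) (c := c) 0
        rw [pow_zero, one_mul] at this
        rw [← this]; exact cQ_mem_range (by omega) (by omega)
      · have := cP_three_mul_add_two (F := F) (k := k) (s := s) (c := c) 0
        rw [pow_zero, one_mul] at this
        rw [← this]; exact cP_mem_range (by omega)
    all_goals obtain ⟨h1, h2⟩ := hi; dsimp only
    · rw [← cQ_three_mul_add_one]; exact cQ_mem_range (by omega) (by omega)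
    · rw [← cP_three_mul_add_two]; exact cP_mem_range (by omega)
  · rcases hx with (rfl | ⟨i, hi, rfl⟩) | ⟨i, hi, rfl⟩
    · exact cR_mem_range (n := 0) (by omega)
    all_goals obtain ⟨h1, h2⟩ := hi; dsimp only
    · rw [← cR_three_mul (by omega)]; exact cR_mem_range (by omega)
    · exact et_pow_mem_range h1 h2

/-- If `g 0 ∈ S` and `g` maps `[1, k - 1]` into `S`, then `g` maps `[0, k)` into `S`. -/
lemma mem_of_zero_of_image {A : Type} {S : Set A} {g : ℕ → A} (h0 : g 0 ∈ S)
    (h : g '' Set.Icc 1 (k - 1) ⊆ S) {i : ℕ} (hi : i < k) : g i ∈ S := by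
  rcases Nat.eq_zero_or_pos i with rfl | h1
  · exact h0
  · exact h ⟨i, ⟨h1, by omega⟩, rfl⟩

lemma range_subset_BB : Set.range (path F k s c) ⊆ BB F k s c := by
  have key : ∀ {n}, n < 3 * k → ∃ i < k, n = 3 * i ∨ n = 3 * i + 1 ∨ n = 3 * i + 2 :=
    fun {n} _ => ⟨n / 3, by omega, by omega⟩
  rintro _ ⟨i | i | i | i, rfl⟩
  · change cP F k s c i ∈ _
    obtain ⟨j, hj, h | h | h⟩ := key i.2 <;> rw [h]
    · refine mem_of_zero_of_image (g := fun j => cP F k s c (3 * j)) ?_ ?_ hj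
      · exact .inl <| .inl <| .inl <| .inl <| .inl <| .inl <| .inl <| .inl rfl
      · rintro _ ⟨m, hm, rfl⟩
        refine .inl <| .inl <| .inl <| .inl <| .inr ⟨m, hm, ?_⟩
        exact (cP_three_mul (by have := hm.1; omega)).symm
    · rw [cP_three_mul_add_one]
      refine mem_of_zero_of_image (g := fun j => ABG F k s c ^ j * Al F k s c) ?_ ?_ hj
      · exact .inl <| .inl <| .inl <| .inl <| .inl <| .inl <| .inl <| .inr <| .inl (by simp)
      · exact fun x hx => .inl <| .inl <| .inl <| .inl <| .inl <| .inr hx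
    · rw [cP_three_mul_add_two]
      refine mem_of_zero_of_image
        (g := fun j => GAB F k s c ^ j * (Ga F k s c * Al F k s c)) ?_ ?_ hj
      · exact .inl <| .inr <| .inl <| .inl <| .inr (by simp)
      · exact fun x hx => .inl <| .inr <| .inr hx
  · change cQ F k s c (i + 1) ∈ _
    obtain ⟨j, hj, h | h | h⟩ := key i.2 <;> rw [h]
    · rw [cQ_three_mul_add_one]
      refine mem_of_zero_of_image (g := fun j => GAB F k s c ^ j * Ga F k s c) ?_ ?_ hj
      · exact .inl <| .inr <| .inl <| .inl <| .inl (by simp)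
      · exact fun x hx => .inl <| .inr <| .inl <| .inr hx
    · rw [show 3 * j + 1 + 1 = 3 * j + 2 from rfl, cQ_three_mul_add_two]
      refine mem_of_zero_of_image
        (g := fun j => BGA F k s c ^ j * (Be F k s c * Ga F k s c)) ?_ ?_ hj
      · exact .inl <| .inl <| .inl <| .inl <| .inl <| .inl <| .inl <| .inr <| .inr <| .inl (by simp)
      · exact fun x hx => .inl <| .inl <| .inl <| .inr hx
    · rw [show 3 * j + 2 + 1 = 3 * (j + 1) from rfl, cQ_three_mul (show j + 1 ≠ 0 by omega)]
      rcases eq_or_ne (j + 1) k with h' | h'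
      · rw [h']
        exact .inl <| .inl <| .inl <| .inl <| .inl <| .inl <| .inl <| .inr <| .inr <| .inr rfl
      · exact .inl <| .inl <| .inl <| .inl <| .inl <| .inl <| .inr
          ⟨j + 1, ⟨by omega, by omega⟩, rfl⟩
  · change cR F k s c i ∈ _
    obtain ⟨j, hj, h | h | h⟩ := key i.2 <;> rw [h]
    · refine mem_of_zero_of_image (g := fun j => cR F k s c (3 * j)) ?_ ?_ hj
      · exact .inr <| .inl <| .inl rfl
      · rintro _ ⟨m, hm, rfl⟩
        refine .inr <| .inl <| .inr ⟨m, hm, ?_⟩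
        exact (cR_three_mul (by have := hm.1; omega)).symm
    · rw [cR_three_mul_add_one]
      refine mem_of_zero_of_image (g := fun j => BGA F k s c ^ j * Be F k s c) ?_ ?_ hj
      · exact .inl <| .inl <| .inr <| .inl <| .inl <| .inl (by simp)
      · exact fun x hx => .inl <| .inl <| .inr <| .inl <| .inr hx
    · rw [cR_three_mul_add_two]
      refine mem_of_zero_of_image
        (g := fun j => ABG F k s c ^ j * (Al F k s c * Be F k s c)) ?_ ?_ hj
      · exact .inl <| .inl <| .inr <| .inl <| .inl <| .inr (by simp)
      · exact fun x hx => .inl <| .inl <| .inr <| .inr hx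
  · exact .inr <| .inr ⟨i + 1, ⟨by omega, i.2⟩, rfl⟩

lemma range_path (hk : 1 ≤ k) : Set.range (path F k s c) = BB F k s c :=
  range_subset_BB.antisymm (BB_subset_range hk)

end Chains

/-- **Basis of `A^{k,s}_c` (dihedral type).**  For `k, s ≥ 1` and `c ∈ {0,1}` the set
`𝓑 = 𝓑₁₁ ∪ 𝓑₁₂ ∪ 𝓑₂₁ ∪ 𝓑₂₂` is an F-basis of `A^{k,s}_c`; in particular
`dim_F A^{k,s}_c = 9k + s`. -/
theorem dihedral_standard_basis
    (F : Type) [Field F] [IsAlgClosed F] [CharP F 2]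
    (k s : ℕ) (hk : 1 ≤ k) (hs : 1 ≤ s) (c : F) (hc : c = 0 ∨ c = 1) :
    LinearIndependent F (fun p : (BB F k s c) => (p : DA F k s c)) ∧
    Submodule.span F (BB F k s c) = ⊤ ∧
    Module.finrank F (DA F k s c) = 9 * k + s := by
  have hli : LinearIndependent F (path F k s c) := linearIndependent_path hk hs
  have hsp : Submodule.span F (Set.range (path F k s c)) = ⊤ := span_range_path hk hs
  refine ⟨?_, ?_, ?_⟩
  · rw [← range_path hk]
    exact hli.linearIndepOn_id
  · rw [← range_path hk, hsp]
  · rw [Module.finrank_eq_card_basis (Module.Basis.mk hli hsp.ge)]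
    simp only [Idx, Fintype.card_sum, Fintype.card_fin]
    ring

end DihedralPaper

end
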